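/- Assume (SH), (H1) and φ ∈ C¹(ℝⁿ), and let (t,x) ∈ [t₀,T)×ℝⁿ be such that 0 ∈ ∂*V(t,x). Then there exists a trajectory y:[t,T]→ℝⁿ that is optimal for the Mayer problem P(t,x) and satisfies ∇φ(y(T)) = 0; consequently the unique dual arc associated with y is identically zero. -/

import Mathlib

open MeasureTheory Filter Metric Set Topology
open scoped RealInnerProductSpace ENNReal NNReal Pointwise

noncomputable section

variable {E : Type*} [NormedAddCommGroup E] [InnerProductSpace ℝ E] [CompleteSpace E]

/-- The Hamiltonian `H(x,p) = sup_{v ∈ F x} ⟪v,p⟫` associated with `F`. -/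
def Ham (F : E → Set E) (x p : E) : ℝ :=
  sSup ((fun v => ⟪v, p⟫) '' F x)

/-- Standing hypotheses (SH): nonempty convex compact values, local Lipschitz continuity
with respect to the Hausdorff metric, and sublinear growth. -/
def StandingHyp (F : E → Set E) : Prop :=
  (∀ x, (F x).Nonempty ∧ Convex ℝ (F x) ∧ IsCompact (F x)) ∧
  (∀ x : E, ∃ ε > (0:ℝ), ∃ c : ℝ, 0 ≤ c ∧ ∀ y ∈ ball x ε, ∀ z ∈ ball x ε,
    EMetric.hausdorffEdist (F y) (F z) ≤ ENNReal.ofReal (c * dist y z)) ∧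
  (∃ r > (0:ℝ), ∀ x : E, ∀ v ∈ F x, ‖v‖ ≤ r * (1 + ‖x‖))

/-- `f` is semiconvex on `K` with constant `c`. -/
def SemiconvexWith (f : E → ℝ) (K : Set E) (c : ℝ) : Prop :=
  ∀ x h : E, x + h ∈ K → x - h ∈ K → -(c * ‖h‖ ^ 2) ≤ f (x + h) + f (x - h) - 2 * f x

/-- `f` is semiconcave on `K` with constant `c`. -/
def SemiconcaveWith (f : E → ℝ) (K : Set E) (c : ℝ) : Prop :=
  ∀ x h : E, x + h ∈ K → x - h ∈ K → f (x + h) + f (x - h) - 2 * f x ≤ c * ‖h‖ ^ 2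

def LocSemiconcave (f : E → ℝ) : Prop :=
  ∀ x : E, ∃ ε > (0:ℝ), ∃ c : ℝ, SemiconcaveWith f (ball x ε) c

def LocSemiconvex (f : E → ℝ) : Prop :=
  ∀ x : E, ∃ ε > (0:ℝ), ∃ c : ℝ, SemiconvexWith f (ball x ε) c

open scoped Classical in
/-- The gradient `∇ₚH(x,p)` of `H(x,·)` at `p` (junk value `0` if it does not exist). -/
def gradpH (F : E → Set E) (x p : E) : E :=
  if h : ∃ g, HasGradientAt (fun q => Ham F x q) g p then h.choose else 0

/-- Hypothesis (H1): semiconvexity of `H(·,p)` with constant `c‖p‖` on compact convex sets,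
existence of `∇ₚH(x,p)` for `p ≠ 0`, and local Lipschitz continuity of `x ↦ ∇ₚH(x,p)`,
uniformly for `p` in compact subsets of `ℝⁿ ∖ {0}`. -/
def HypH1 (F : E → Set E) : Prop :=
  (∀ K : Set E, K.Nonempty → Convex ℝ K → IsCompact K →
    ∃ c : ℝ, 0 ≤ c ∧ ∀ p : E, SemiconvexWith (fun x => Ham F x p) K (c * ‖p‖)) ∧
  (∀ x p : E, p ≠ 0 → HasGradientAt (fun q => Ham F x q) (gradpH F x p) p) ∧
  (∀ K : Set E, K.Nonempty → Convex ℝ K → IsCompact K →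
    ∀ P : Set E, IsCompact P → (0:E) ∉ P →
      ∃ L : ℝ≥0, ∀ p ∈ P, LipschitzOnWith L (fun x => gradpH F x p) K)

/-- Fréchet subdifferential `∂⁻f(x)`. -/
def FSub (f : E → ℝ) (x : E) : Set E :=
  {p | ∀ ε > (0:ℝ), ∀ᶠ y in 𝓝 x, -(ε * ‖y - x‖) ≤ f y - f x - ⟪p, y - x⟫}

/-- Fréchet superdifferential `∂⁺f(x)`. -/
def FSuper (f : E → ℝ) (x : E) : Set E :=
  {p | ∀ ε > (0:ℝ), ∀ᶠ y in 𝓝 x, f y - f x - ⟪p, y - x⟫ ≤ ε * ‖y - x‖}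

/-- Proximal superdifferential `∂^{+,pr}f(x)`. -/
def ProxSuper (f : E → ℝ) (x : E) : Set E :=
  {p | ∃ c : ℝ, 0 ≤ c ∧ ∃ ρ > (0:ℝ), ∀ y ∈ closedBall x ρ,
    f y - f x - ⟪p, y - x⟫ ≤ c * ‖y - x‖ ^ 2}

/-- Clarke's generalized gradient of `f` at `x`:
`ζ ∈ ∂f(x)` iff `⟪ζ,v⟫ ≤ limsup_{y→x, h→0⁺} (f(y+hv)-f(y))/h` for all `v`. -/
def ClarkeGrad (f : E → ℝ) (x : E) : Set E :=
  {ζ | ∀ v : E, ∀ ε > (0:ℝ),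
    ∃ᶠ q : E × ℝ in (𝓝 x) ×ˢ (𝓝[>] (0:ℝ)),
      ⟪ζ, v⟫ - ε ≤ (f (q.1 + q.2 • v) - f q.1) / q.2}

/-- `x` is absolutely continuous on `[t0,T]` with (a.e.) derivative `x'`. -/
def ACArc (t0 T : ℝ) (x x' : ℝ → E) : Prop :=
  IntervalIntegrable x' volume t0 T ∧
  (∀ s ∈ Icc t0 T, x s = x t0 + ∫ r in t0..s, x' r) ∧
  (∀ᵐ s ∂volume, s ∈ Icc t0 T → HasDerivAt x (x' s) s)

/-- `x` is a trajectory of the differential inclusion `x' ∈ F(x)` on `[t0,T]`. -/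
def IsTraj (F : E → Set E) (t0 T : ℝ) (x x' : ℝ → E) : Prop :=
  ACArc t0 T x x' ∧ ∀ᵐ s ∂volume, s ∈ Icc t0 T → x' s ∈ F (x s)

/-- `x` is an optimal trajectory for the Mayer problem `P(t0,x0)`. -/
def IsOptimal (F : E → Set E) (φ : E → ℝ) (t0 T : ℝ) (x0 : E) (x x' : ℝ → E) : Prop :=
  IsTraj F t0 T x x' ∧ x t0 = x0 ∧
  ∀ y y' : ℝ → E, IsTraj F t0 T y y' → y t0 = x0 → φ (x T) ≤ φ (y T)

/-- The value function of the Mayer problem. -/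
def valueFn (F : E → Set E) (φ : E → ℝ) (T t : ℝ) (x : E) : ℝ :=
  sInf {r | ∃ y y' : ℝ → E, IsTraj F t T y y' ∧ y t = x ∧ r = φ (y T)}

/-- Fréchet superdifferential of `W` in the pair `(t,x)`. -/
def FSuperPair (W : ℝ → E → ℝ) (t : ℝ) (x : E) : Set (ℝ × E) :=
  {q | ∀ ε > (0:ℝ), ∀ᶠ sy : ℝ × E in 𝓝 (t, x),
    W sy.1 sy.2 - W t x - q.1 * (sy.1 - t) - ⟪q.2, sy.2 - x⟫ ≤
      ε * ‖((sy.1 - t, sy.2 - x) : ℝ × E)‖}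

/-- Fréchet subdifferential of `W` in the pair `(t,x)`. -/
def FSubPair (W : ℝ → E → ℝ) (t : ℝ) (x : E) : Set (ℝ × E) :=
  {q | ∀ ε > (0:ℝ), ∀ᶠ sy : ℝ × E in 𝓝 (t, x),
    -(ε * ‖((sy.1 - t, sy.2 - x) : ℝ × E)‖) ≤
      W sy.1 sy.2 - W t x - q.1 * (sy.1 - t) - ⟪q.2, sy.2 - x⟫}

/-- Proximal superdifferential of `W` in the pair `(t,x)`. -/
def ProxSuperPair (W : ℝ → E → ℝ) (t : ℝ) (x : E) : Set (ℝ × E) :=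
  {q | ∃ c : ℝ, 0 ≤ c ∧ ∃ ρ > (0:ℝ), ∀ s : ℝ, ∀ y : E,
    dist ((s, y) : ℝ × E) ((t, x) : ℝ × E) ≤ ρ →
      W s y - W t x - q.1 * (s - t) - ⟪q.2, y - x⟫ ≤ c * ‖((s - t, y - x) : ℝ × E)‖ ^ 2}

/-- `V` is differentiable at `(t,x)` with (pair) gradient `q = (∂ₜV, ∇ₓV)`. -/
def HasGradPair (W : ℝ → E → ℝ) (t : ℝ) (x : E) (q : ℝ × E) : Prop :=
  HasFDerivAt (fun sy : ℝ × E => W sy.1 sy.2)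
    (q.1 • ContinuousLinearMap.fst ℝ ℝ E +
      (innerSL ℝ q.2).comp (ContinuousLinearMap.snd ℝ ℝ E)) (t, x)

/-- The reachable (limiting) gradient `∂*W(t,x)`. -/
def ReachGradPair (W : ℝ → E → ℝ) (t : ℝ) (x : E) : Set (ℝ × E) :=
  {q | ∃ u g : ℕ → ℝ × E,
    (∀ i, HasGradPair W (u i).1 (u i).2 (g i)) ∧
    Tendsto u atTop (𝓝 (t, x)) ∧ Tendsto g atTop (𝓝 q)}

/-- Normal cone (of convex analysis) to `A` at `z`. -/
def normalConeAt (A : Set E) (z : E) : Set E :=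
  {p | ∀ v ∈ A, ⟪p, v - z⟫ ≤ 0}

/-- `A` is `R`-convex. -/
def RConvex (A : Set E) (R : ℝ) : Prop :=
  ∀ z ∈ frontier A, ∀ y ∈ frontier A, ∀ n ∈ normalConeAt A z, ∀ m ∈ normalConeAt A y,
    ‖n‖ = 1 → ‖m‖ = 1 → ‖z - y‖ ≤ R * ‖n - m‖

/-- `F` is locally strongly convex. -/
def LocStronglyConvex (F : E → Set E) : Prop :=
  ∀ K : Set E, IsCompact K → ∃ R > (0:ℝ), ∀ x ∈ K, RConvex (F x) R

/-- `ℝⁿ` as a Euclidean space. -/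
abbrev Euc (n : ℕ) : Type := EuclideanSpace ℝ (Fin n)

set_option linter.unusedSectionVars false

/-- A bounded, globally Lipschitz multimap with nonempty convex compact values. -/
structure LipMultimap (G : E → Set E) (L M : ℝ) : Prop where
  nonempty : ∀ x, (G x).Nonempty
  convex : ∀ x, Convex ℝ (G x)
  compact : ∀ x, IsCompact (G x)
  lip : ∀ x y, ∀ v ∈ G x, infDist v (G y) ≤ L * ‖x - y‖
  bound : ∀ x, ∀ v ∈ G x, ‖v‖ ≤ M
  pos : 0 < L

/-- A nearest point of `A` to `u`. -/
def nearestPt (A : Set E) (u : E) : E :=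
  Classical.epsilon fun v => v ∈ A ∧ dist u v = infDist u A

theorem nearestPt_spec {A : Set E} (hA : IsCompact A) (hne : A.Nonempty) (u : E) :
    nearestPt A u ∈ A ∧ dist u (nearestPt A u) = infDist u A := by
  obtain ⟨v, hv, h⟩ := hA.exists_infDist_eq_dist hne u
  exact Classical.epsilon_spec (p := fun v => v ∈ A ∧ dist u v = infDist u A) ⟨v, hv, h.symm⟩

theorem nearestPt_unique {A : Set E} (hc : Convex ℝ A) {u v w : E}
    (hv : v ∈ A) (hdv : dist u v = infDist u A) (hw : w ∈ A) (hdw : dist u w = infDist u A) :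
    v = w := by
  have hm : (1 / 2 : ℝ) • v + (1 / 2 : ℝ) • w ∈ A :=
    hc hv hw (by norm_num) (by norm_num) (by norm_num)
  have h1 := infDist_le_dist_of_mem (x := u) hm
  rw [dist_eq_norm] at hdv hdw h1
  have h2 := parallelogram_law_with_norm ℝ (u - v) (u - w)
  have h3 : (u - v) + (u - w) = (2 : ℝ) • (u - ((1 / 2 : ℝ) • v + (1 / 2 : ℝ) • w)) := by
    module
  have h4 : (u - v) - (u - w) = w - v := by abel
  rw [h3, h4, norm_smul, hdv, hdw] at h2
  have h5 := infDist_nonneg (x := u) (s := A)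
  have h6 : ‖(2 : ℝ)‖ = 2 := by norm_num
  rw [h6] at h2
  have h7 : ‖w - v‖ = 0 := by
    have := norm_nonneg (w - v)
    nlinarith [mul_self_le_mul_self h5 h1]
  exact (sub_eq_zero.1 (norm_eq_zero.1 h7)).symm

namespace LipMultimap

variable {G : E → Set E} {L M : ℝ}

theorem bound_nonneg (hG : LipMultimap G L M) : 0 ≤ M := by
  obtain ⟨v, hv⟩ := hG.nonempty 0
  exact (norm_nonneg v).trans (hG.bound 0 v hv)

theorem infDist_le (hG : LipMultimap G L M) (x y u : E) :
    infDist u (G x) ≤ infDist u (G y) + L * ‖x - y‖ := by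
  obtain ⟨v, hv, h⟩ := (hG.compact y).exists_infDist_eq_dist (hG.nonempty y) u
  have h1 := hG.lip y x v hv
  have h2 := infDist_le_infDist_add_dist (s := G x) (x := u) (y := v)
  rw [norm_sub_rev] at h1
  linarith

theorem continuous_infDist (hG : LipMultimap G L M) :
    Continuous fun p : E × E => infDist p.2 (G p.1) := by
  have hL := hG.pos.le
  have : LipschitzWith (Real.toNNReal (1 + L)) fun p : E × E => infDist p.2 (G p.1) := by
    refine LipschitzWith.of_le_add_mul _ fun p q => ?_
    rw [Real.coe_toNNReal _ (by linarith)]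
    have h1 := hG.infDist_le p.1 q.1 p.2
    have h2 := infDist_le_infDist_add_dist (s := G q.1) (x := p.2) (y := q.2)
    have h3 : dist p.2 q.2 ≤ dist p q := le_max_right _ _
    have h4 : ‖p.1 - q.1‖ ≤ dist p q := by
      rw [← dist_eq_norm]; exact le_max_left _ _
    nlinarith [mul_le_mul_of_nonneg_left h4 hL]
  exact this.continuous

theorem nearestPt_mem (hG : LipMultimap G L M) (x u : E) : nearestPt (G x) u ∈ G x :=
  (nearestPt_spec (hG.compact x) (hG.nonempty x) u).1

theorem dist_nearestPt (hG : LipMultimap G L M) (x u : E) :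
    dist u (nearestPt (G x) u) = infDist u (G x) :=
  (nearestPt_spec (hG.compact x) (hG.nonempty x) u).2

theorem mem_iff_infDist (hG : LipMultimap G L M) {x u : E} : u ∈ G x ↔ infDist u (G x) = 0 :=
  (hG.compact x).isClosed.mem_iff_infDist_zero (hG.nonempty x)

theorem nearestPt_eq (hG : LipMultimap G L M) {x u : E} (hu : u ∈ G x) :
    nearestPt (G x) u = u := by
  have h := hG.dist_nearestPt x u
  rw [hG.mem_iff_infDist.1 hu] at h
  exact (dist_eq_zero.1 h).symm

theorem continuous_nearestPt [FiniteDimensional ℝ E] (hG : LipMultimap G L M) :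
    Continuous fun p : E × E => nearestPt (G p.1) p.2 := by
  rw [continuous_iff_ultrafilter]
  intro p U hU
  have hK : IsCompact (closedBall (0 : E) M) := isCompact_closedBall 0 M
  have hmem : ↑(U.map fun p : E × E => nearestPt (G p.1) p.2) ≤ 𝓟 (closedBall (0 : E) M) := by
    rw [Ultrafilter.coe_map, le_principal_iff, mem_map]
    exact Eventually.of_forall fun q => by
      simpa using hG.bound _ _ (hG.nearestPt_mem q.1 q.2)
  obtain ⟨v, -, hv⟩ := hK.ultrafilter_le_nhds _ hmem
  have hv' : Tendsto (fun p : E × E => nearestPt (G p.1) p.2) U (𝓝 v) := hv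
  have h1 : Tendsto Prod.fst (U : Filter (E × E)) (𝓝 p.1) := (continuous_fst.tendsto p).mono_left hU
  have h2 : Tendsto Prod.snd (U : Filter (E × E)) (𝓝 p.2) := (continuous_snd.tendsto p).mono_left hU
  have hc := hG.continuous_infDist
  have e1 : infDist v (G p.1) = 0 := by
    refine tendsto_nhds_unique ((hc.tendsto (p.1, v)).comp (h1.prodMk_nhds hv')) ?_
    refine tendsto_const_nhds.congr fun q => ?_
    exact (hG.mem_iff_infDist.1 (hG.nearestPt_mem q.1 q.2)).symm
  have e2 : dist p.2 v = infDist p.2 (G p.1) := by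
    refine tendsto_nhds_unique (h2.dist hv') ?_
    refine ((hc.tendsto p).mono_left hU).congr fun q => ?_
    exact (hG.dist_nearestPt q.1 q.2).symm
  have := nearestPt_unique (hG.convex p.1) (hG.mem_iff_infDist.2 e1) e2
    (hG.nearestPt_mem p.1 p.2) (hG.dist_nearestPt p.1 p.2)
  rw [← this]
  exact hv'

end LipMultimap

theorem abs_integral_exp_abs_le {L : ℝ} (hL : 0 < L) (a b : ℝ) :
    |∫ q in a..b, Real.exp (2 * L * |q - a|)| ≤ Real.exp (2 * L * |b - a|) / (2 * L) := by
  rcases le_total a b with h | h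
  · have e : ∫ q in a..b, Real.exp (2 * L * |q - a|) =
        ∫ q in a..b, Real.exp (2 * L * q - 2 * L * a) := by
      refine intervalIntegral.integral_congr fun q hq => ?_
      rw [uIcc_of_le h] at hq
      simp only [abs_of_nonneg (sub_nonneg.2 hq.1)]
      ring_nf
    rw [e, intervalIntegral.integral_comp_mul_sub (f := Real.exp) (by positivity), integral_exp,
      abs_of_nonneg (sub_nonneg.2 h), smul_eq_mul, sub_self, Real.exp_zero, ← mul_sub,
      abs_of_nonneg]
    · rw [div_eq_inv_mul]
      gcongr
      linarith
    · have : 1 ≤ Real.exp (2 * L * (b - a)) := Real.one_le_exp (by nlinarith)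
      exact mul_nonneg (by positivity) (by linarith)
  · have e : ∫ q in a..b, Real.exp (2 * L * |q - a|) =
        ∫ q in a..b, Real.exp ((-(2 * L)) * q - (-(2 * L)) * a) := by
      refine intervalIntegral.integral_congr fun q hq => ?_
      rw [uIcc_of_ge h] at hq
      simp only [abs_of_nonpos (sub_nonpos.2 hq.2)]
      ring_nf
    rw [e, intervalIntegral.integral_comp_mul_sub (f := Real.exp) (by simpa using hL.ne'),
      integral_exp, abs_of_nonpos (sub_nonpos.2 h), smul_eq_mul, sub_self, Real.exp_zero, ← mul_sub,
      inv_neg, neg_mul, abs_neg, abs_of_nonneg]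
    · rw [div_eq_inv_mul, show -(2 * L) * (b - a) = 2 * L * -(b - a) by ring]
      gcongr
      linarith
    · have : 1 ≤ Real.exp (-(2 * L) * (b - a)) := Real.one_le_exp (by nlinarith)
      exact mul_nonneg (by positivity) (by linarith)

theorem norm_integral_le_exp {u : ℝ → E} {A L a b : ℝ} (hL : 0 < L) (hA : 0 ≤ A)
    (h : ∀ᵐ q, q ∈ uIcc a b → ‖u q‖ ≤ A * Real.exp (2 * L * |q - a|)) :
    ‖∫ q in a..b, u q‖ ≤ A / (2 * L) * Real.exp (2 * L * |b - a|) := by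
  have h1 : ‖∫ q in a..b, u q‖ ≤ |∫ q in a..b, A * Real.exp (2 * L * |q - a|)| := by
    refine intervalIntegral.norm_integral_le_abs_of_norm_le ?_ ?_
    · rw [ae_restrict_iff' measurableSet_uIoc]
      filter_upwards [h] with q hq hq'
      exact hq (uIoc_subset_uIcc hq')
    · exact Continuous.intervalIntegrable (by fun_prop) _ _
  rw [intervalIntegral.integral_const_mul, abs_mul, abs_of_nonneg hA] at h1
  calc _ ≤ _ := h1
    _ ≤ A * (Real.exp (2 * L * |b - a|) / (2 * L)) := by
      gcongr; exact abs_integral_exp_abs_le hL a b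
    _ = _ := by ring

/-- A two-sided Gronwall inequality for primitives. -/
theorem add_norm_le_exp_of_primitive {z u : ℝ → E} {L κ a b : ℝ} (hL : 0 < L) (hκ : 0 ≤ κ)
    (hz : ContinuousOn z (uIcc a b)) (hzu : ∀ s ∈ uIcc a b, z s = z a + ∫ q in a..s, u q)
    (hu : ∀ᵐ q, q ∈ uIcc a b → ‖u q‖ ≤ L * (κ + ‖z q‖)) {s : ℝ} (hs : s ∈ uIcc a b) :
    κ + ‖z s‖ ≤ 2 * (κ + ‖z a‖) * Real.exp (2 * L * |s - a|) := by
  obtain ⟨m, hm, hmax⟩ := isCompact_uIcc.exists_isMaxOn nonempty_uIcc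
    (f := fun s => (κ + ‖z s‖) * Real.exp (-(2 * L * |s - a|))) (by fun_prop)
  set S := (κ + ‖z m‖) * Real.exp (-(2 * L * |m - a|)) with hS
  have hS0 : 0 ≤ S := by positivity
  have key : ∀ q ∈ uIcc a b, κ + ‖z q‖ ≤ S * Real.exp (2 * L * |q - a|) := by
    intro q hq
    have : (κ + ‖z q‖) * Real.exp (-(2 * L * |q - a|)) ≤ S := hmax hq
    calc κ + ‖z q‖ = (κ + ‖z q‖) * Real.exp (-(2 * L * |q - a|)) * Real.exp (2 * L * |q - a|) := by
          rw [mul_assoc, ← Real.exp_add]; simp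
      _ ≤ _ := by gcongr
  have h1 : ‖∫ q in a..m, u q‖ ≤ L * S / (2 * L) * Real.exp (2 * L * |m - a|) := by
    refine norm_integral_le_exp hL (by positivity) ?_
    filter_upwards [hu] with q hq hq'
    have hq'' : q ∈ uIcc a b := uIcc_subset_uIcc_left hm hq'
    have := mul_le_mul_of_nonneg_left (key q hq'') hL.le
    linarith [hq hq'']
  have h2 : κ + ‖z m‖ ≤ κ + ‖z a‖ + S / 2 * Real.exp (2 * L * |m - a|) := by
    have h3 : L * S / (2 * L) = S / 2 := by field_simp
    rw [h3] at h1
    have := norm_add_le (z a) (∫ q in a..m, u q)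
    rw [← hzu m hm] at this
    linarith
  have h4 : S ≤ (κ + ‖z a‖) * Real.exp (-(2 * L * |m - a|)) + S / 2 := by
    calc S ≤ (κ + ‖z a‖ + S / 2 * Real.exp (2 * L * |m - a|)) * Real.exp (-(2 * L * |m - a|)) := by
          rw [hS]; gcongr
      _ = (κ + ‖z a‖) * Real.exp (-(2 * L * |m - a|)) + S / 2 *
          (Real.exp (2 * L * |m - a|) * Real.exp (-(2 * L * |m - a|))) := by ring
      _ = _ := by rw [← Real.exp_add]; simp
  have h5 : Real.exp (-(2 * L * |m - a|)) ≤ 1 := Real.exp_le_one_iff.2 (by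
    have := abs_nonneg (m - a); nlinarith)
  have h6 : S ≤ 2 * (κ + ‖z a‖) := by
    have := mul_le_mul_of_nonneg_left h5 (show 0 ≤ κ + ‖z a‖ by positivity)
    linarith
  exact (key s hs).trans (by gcongr)

theorem intervalIntegrable_of_norm_le {u : ℝ → E} {M : ℝ} (hu : AEStronglyMeasurable u volume)
    (hM : ∀ s, ‖u s‖ ≤ M) (a b : ℝ) : IntervalIntegrable u volume a b :=
  (intervalIntegrable_const (c := M)).mono_fun' hu.restrict (Eventually.of_forall hM)

/-- Arcs whose difference quotients satisfy the integrated form of the inclusion `z' ∈ G z`. -/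
structure QuotTraj (G : E → Set E) (L M : ℝ) (z : ℝ → E) : Prop where
  lip : ∀ s r, ‖z s - z r‖ ≤ M * |s - r|
  quot : ∀ s r, s < r → infDist ((r - s)⁻¹ • (z r - z s)) (G (z s)) ≤ L * M * (r - s)

theorem LipMultimap.infDist_quotient_le {G : E → Set E} {L M : ℝ} (hG : LipMultimap G L M)
    {z u : ℝ → E} {s r : ℝ} (hsr : s < r) (hi : IntervalIntegrable u volume s r)
    (hz : z r - z s = ∫ q in s..r, u q) (hlip : ∀ q ∈ Icc s r, ‖z q - z s‖ ≤ M * (q - s))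
    (hu : ∀ᵐ q, q ∈ Icc s r → u q ∈ G (z q)) :
    infDist ((r - s)⁻¹ • (z r - z s)) (G (z s)) ≤ L * M * (r - s) := by
  rw [hz, ← interval_average_eq]
  have hM := hG.bound_nonneg
  have hL := hG.pos.le
  have hcl : IsClosed {v : E | infDist v (G (z s)) ≤ L * M * (r - s)} :=
    isClosed_le (continuous_infDist_pt _) continuous_const
  have hcv : Convex ℝ {v : E | infDist v (G (z s)) ≤ L * M * (r - s)} := by
    have hδ : 0 ≤ L * M * (r - s) := mul_nonneg (mul_nonneg hL hM) (sub_nonneg.2 hsr.le)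
    convert! (hG.convex (z s)).cthickening (L * M * (r - s)) using 1
    ext v
    rw [mem_cthickening_iff,
      ENNReal.le_ofReal_iff_toReal_le (infEDist_ne_top (hG.nonempty (z s))) hδ]
    rfl
  refine hcv.set_average_mem hcl ?_ ?_ ?_ ?_
  · rw [uIoc_of_le hsr.le]; simpa using hsr
  · rw [uIoc_of_le hsr.le]; simp
  · rw [ae_restrict_iff' measurableSet_uIoc, uIoc_of_le hsr.le]
    filter_upwards [hu] with q hq hq'
    have hq'' := Ioc_subset_Icc_self hq'
    have h1 := hG.lip (z q) (z s) (u q) (hq hq'')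
    have h2 := mul_le_mul_of_nonneg_left (hlip q hq'') hL
    have h3 : L * M * (q - s) ≤ L * M * (r - s) := by gcongr; exact hq''.2
    change infDist _ _ ≤ _
    linarith
  · exact hi.def'

/-- Filippov's successive approximations of the velocity of a trajectory of `G` through `(a, w)`. -/
def filippovIter (G : E → Set E) (a : ℝ) (w : E) (u₀ : ℝ → E) : ℕ → ℝ → E
  | 0 => u₀
  | k + 1 => fun s =>
      nearestPt (G (w + ∫ q in a..s, filippovIter G a w u₀ k q)) (filippovIter G a w u₀ k s)

namespace LipMultimap

variable {G : E → Set E} {L M : ℝ} {a : ℝ} {w : E} {u₀ : ℝ → E}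

theorem filippovIter_spec [FiniteDimensional ℝ E] (hG : LipMultimap G L M)
    (hu : AEStronglyMeasurable u₀ volume) (hM : ∀ s, ‖u₀ s‖ ≤ M) (k : ℕ) :
    AEStronglyMeasurable (filippovIter G a w u₀ k) volume ∧
      ∀ s, ‖filippovIter G a w u₀ k s‖ ≤ M := by
  induction k with
  | zero => exact ⟨hu, hM⟩
  | succ k ih =>
    have hc : Continuous fun s => w + ∫ q in a..s, filippovIter G a w u₀ k q :=
      continuous_const.add
        (intervalIntegral.continuous_primitive (intervalIntegrable_of_norm_le ih.1 ih.2) a)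
    exact ⟨hG.continuous_nearestPt.comp_aestronglyMeasurable
      (hc.aestronglyMeasurable.prodMk ih.1), fun s => hG.bound _ _ (hG.nearestPt_mem _ _)⟩

theorem norm_filippovIter_succ_sub_le [FiniteDimensional ℝ E] (hG : LipMultimap G L M)
    (hu : AEStronglyMeasurable u₀ volume) (hM : ∀ s, ‖u₀ s‖ ≤ M) {δ s : ℝ} (hδ : 0 ≤ δ)
    (hs : ∀ r ∈ uIcc a s, infDist (u₀ r) (G (w + ∫ q in a..r, u₀ q)) ≤ δ) (k : ℕ) :
    ∀ r ∈ uIcc a s, ‖filippovIter G a w u₀ (k + 1) r - filippovIter G a w u₀ k r‖ ≤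
      δ * (1 / 2) ^ k * Real.exp (2 * L * |r - a|) := by
  have hL := hG.pos
  induction k with
  | zero =>
    intro r hr
    have h1 := hG.dist_nearestPt (w + ∫ q in a..r, u₀ q) (u₀ r)
    rw [dist_comm, dist_eq_norm] at h1
    have h2 : 1 ≤ Real.exp (2 * L * |r - a|) := Real.one_le_exp (by positivity)
    calc _ = infDist (u₀ r) (G (w + ∫ q in a..r, u₀ q)) := h1
      _ ≤ δ := hs r hr
      _ ≤ _ := by simpa using le_mul_of_one_le_right hδ h2
  | succ k ih =>
    intro r hr
    have i1 := hG.filippovIter_spec (a := a) (w := w) hu hM k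
    have i2 := hG.filippovIter_spec (a := a) (w := w) hu hM (k + 1)
    have h1 := hG.dist_nearestPt (w + ∫ q in a..r, filippovIter G a w u₀ (k + 1) q)
      (filippovIter G a w u₀ (k + 1) r)
    rw [dist_comm, dist_eq_norm] at h1
    have h2 := hG.lip (w + ∫ q in a..r, filippovIter G a w u₀ k q)
      (w + ∫ q in a..r, filippovIter G a w u₀ (k + 1) q) (filippovIter G a w u₀ (k + 1) r)
      (hG.nearestPt_mem _ _)
    rw [add_sub_add_left_eq_sub, norm_sub_rev, ← intervalIntegral.integral_sub
      (intervalIntegrable_of_norm_le i2.1 i2.2 a r)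
      (intervalIntegrable_of_norm_le i1.1 i1.2 a r)] at h2
    have h3 : ‖∫ q in a..r, (filippovIter G a w u₀ (k + 1) q - filippovIter G a w u₀ k q)‖ ≤
        δ * (1 / 2) ^ k / (2 * L) * Real.exp (2 * L * |r - a|) :=
      norm_integral_le_exp hL (by positivity) (Eventually.of_forall fun q hq =>
        ih q (uIcc_subset_uIcc_left hr hq))
    calc _ = infDist (filippovIter G a w u₀ (k + 1) r)
            (G (w + ∫ q in a..r, filippovIter G a w u₀ (k + 1) q)) := h1
      _ ≤ L * (δ * (1 / 2) ^ k / (2 * L) * Real.exp (2 * L * |r - a|)) :=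
          h2.trans (by gcongr)
      _ = _ := by field_simp; ring

/-- **Filippov's theorem** for a bounded globally Lipschitz multimap: near every approximate
trajectory there is a trajectory, at a distance controlled by the defect. -/
theorem filippov [FiniteDimensional ℝ E] (hG : LipMultimap G L M) (a : ℝ) (w : E)
    (hu : AEStronglyMeasurable u₀ volume) (hM : ∀ s, ‖u₀ s‖ ≤ M) :
    ∃ z, QuotTraj G L M z ∧ z a = w ∧ ∀ s δ, 0 ≤ δ →
      (∀ r ∈ uIcc a s, infDist (u₀ r) (G (w + ∫ q in a..r, u₀ q)) ≤ δ) →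
      ‖z s - (w + ∫ q in a..s, u₀ q)‖ ≤ δ / L * Real.exp (2 * L * |s - a|) := by
  have hL := hG.pos
  have hM0 := hG.bound_nonneg
  set U := filippovIter G a w u₀
  have hspec := hG.filippovIter_spec (a := a) (w := w) hu hM
  have hdef : ∀ r, infDist (u₀ r) (G (w + ∫ q in a..r, u₀ q)) ≤ 2 * M := fun r => by
    obtain ⟨v, hv⟩ := hG.nonempty (w + ∫ q in a..r, u₀ q)
    calc _ ≤ dist (u₀ r) v := infDist_le_dist_of_mem hv
      _ ≤ ‖u₀ r‖ + ‖v‖ := by rw [dist_eq_norm]; exact norm_sub_le _ _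
      _ ≤ 2 * M := by linarith [hM r, hG.bound _ _ hv]
  have hstep : ∀ s δ, 0 ≤ δ →
      (∀ r ∈ uIcc a s, infDist (u₀ r) (G (w + ∫ q in a..r, u₀ q)) ≤ δ) →
      ∀ k, ∀ r ∈ uIcc a s, dist (U k r) (U (k + 1) r) ≤
        δ * Real.exp (2 * L * |r - a|) * (1 / 2) ^ k := fun s δ hδ h k r hr => by
    rw [dist_comm, dist_eq_norm]
    exact (hG.norm_filippovIter_succ_sub_le hu hM hδ h k r hr).trans_eq (by ring)
  have hlim : ∀ s, ∃ v, Tendsto (fun k => U k s) atTop (𝓝 v) := fun s =>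
    cauchySeq_tendsto_of_complete (cauchySeq_of_le_geometric (1 / 2) _ (by norm_num)
      fun k => hstep s (2 * M) (by positivity) (fun r _ => hdef r) k s right_mem_uIcc)
  choose u hulim using hlim
  have humeas : AEStronglyMeasurable u volume :=
    aestronglyMeasurable_of_tendsto_ae atTop (fun k => (hspec k).1) (Eventually.of_forall hulim)
  have huM : ∀ s, ‖u s‖ ≤ M := fun s =>
    le_of_tendsto (hulim s).norm (Eventually.of_forall fun k => (hspec k).2 s)
  have hui := intervalIntegrable_of_norm_le humeas huM
  set z : ℝ → E := fun s => w + ∫ q in a..s, u q with hz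
  have hxlim : ∀ s, Tendsto (fun k => w + ∫ q in a..s, U k q) atTop (𝓝 (z s)) := fun s => by
    refine tendsto_const_nhds.add ?_
    refine intervalIntegral.tendsto_integral_filter_of_dominated_convergence (fun _ => M)
      (Eventually.of_forall fun k => (hspec k).1.restrict)
      (Eventually.of_forall fun k => Eventually.of_forall fun r _ => (hspec k).2 r)
      intervalIntegrable_const (Eventually.of_forall fun r _ => hulim r)
  have humem : ∀ s, u s ∈ G (z s) := fun s => by
    rw [hG.mem_iff_infDist]
    refine tendsto_nhds_unique ((hG.continuous_infDist.tendsto (z s, u s)).comp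
      ((hxlim s).prodMk_nhds ((tendsto_add_atTop_iff_nat 1).2 (hulim s)))) ?_
    refine tendsto_const_nhds.congr fun k => ?_
    exact (hG.mem_iff_infDist.1 (hG.nearestPt_mem _ _)).symm
  have hzsub : ∀ s r, z r - z s = ∫ q in s..r, u q := fun s r => by
    simp only [hz, add_sub_add_left_eq_sub]
    exact intervalIntegral.integral_interval_sub_left (hui a r) (hui a s)
  have hzlip : ∀ s r, ‖z s - z r‖ ≤ M * |s - r| := fun s r => by
    rw [hzsub]
    exact intervalIntegral.norm_integral_le_of_norm_le_const fun q _ => huM q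
  refine ⟨z, ⟨hzlip, fun s r hsr => ?_⟩, by simp [hz], fun s δ hδ h => ?_⟩
  · refine hG.infDist_quotient_le hsr (hui s r) (hzsub s r) (fun q hq => ?_)
      (Eventually.of_forall fun q _ => humem q)
    have := hzlip q s
    rwa [abs_of_nonneg (sub_nonneg.2 hq.1)] at this
  · have h1 : ∀ r ∈ uIcc a s, ‖u r - u₀ r‖ ≤ 2 * δ * Real.exp (2 * L * |r - a|) := fun r hr => by
      have := dist_le_of_le_geometric_of_tendsto₀ (1 / 2) _ (by norm_num)
        (fun k => hstep s δ hδ h k r hr) (hulim r)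
      rw [dist_comm, dist_eq_norm] at this
      exact this.trans_eq (by ring)
    have h2 := norm_integral_le_exp (a := a) (b := s) (u := fun r => u r - u₀ r) hL
      (by positivity : 0 ≤ 2 * δ) (Eventually.of_forall h1)
    rw [intervalIntegral.integral_sub (hui a s) (intervalIntegrable_of_norm_le hu hM a s)] at h2
    simp only [hz, add_sub_add_left_eq_sub]
    exact h2.trans_eq (by field_simp)

end LipMultimap

theorem integral_deriv_eq_sub_of_lipschitzWith [FiniteDimensional ℝ E] {z : ℝ → E} {K : ℝ≥0}
    (hz : LipschitzWith K z) (a b : ℝ) : ∫ s in a..b, deriv z s = z b - z a := by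
  have hmeas : AEStronglyMeasurable (deriv z) volume := aestronglyMeasurable_deriv z volume
  have hint : IntervalIntegrable (deriv z) volume a b :=
    intervalIntegrable_of_norm_le hmeas (fun s => norm_deriv_le_of_lipschitz hz) a b
  refine ext_inner_left ℝ fun c => ?_
  have hlip : LipschitzWith (‖innerSL ℝ c‖₊ * K) fun s => ⟪c, z s⟫ :=
    (innerSL ℝ c).lipschitz.comp hz
  have h1 :=
    (hlip.lipschitzOnWith (s := uIcc a b)).absolutelyContinuousOnInterval.integral_deriv_eq_sub
  have h2 : ∫ s in a..b, deriv (fun s => ⟪c, z s⟫) s = ∫ s in a..b, innerSL ℝ c (deriv z s) := by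
    refine intervalIntegral.integral_congr_ae ?_
    filter_upwards [hz.ae_differentiableAt (μ := volume)] with s hs _
    exact ((innerSL ℝ c).hasFDerivAt.comp_hasDerivAt s hs.hasDerivAt).deriv
  rw [h2, (innerSL ℝ c).intervalIntegral_comp_comm hint] at h1
  rw [inner_sub_right]
  simpa using h1

namespace QuotTraj

variable {G : E → Set E} {L M : ℝ} {z : ℝ → E}

theorem lipschitzWith (hz : QuotTraj G L M z) : LipschitzWith (Real.toNNReal M) z := by
  refine LipschitzWith.of_dist_le_mul fun s r => ?_
  rw [dist_eq_norm, Real.dist_eq]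
  exact (hz.lip s r).trans (by gcongr; exact Real.le_coe_toNNReal M)

theorem ae_deriv_mem [FiniteDimensional ℝ E] (hG : LipMultimap G L M) (hz : QuotTraj G L M z) :
    ∀ᵐ s, HasDerivAt z (deriv z s) s ∧ deriv z s ∈ G (z s) := by
  filter_upwards [hz.lipschitzWith.ae_differentiableAt (μ := volume)] with s hs
  refine ⟨hs.hasDerivAt, hG.mem_iff_infDist.2 (le_antisymm ?_ infDist_nonneg)⟩
  have h1 : Tendsto (slope z s) (𝓝[>] s) (𝓝 (deriv z s)) :=
    (hasDerivAt_iff_tendsto_slope.1 hs.hasDerivAt).mono_left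
      (nhdsWithin_mono _ fun r hr => ne_of_gt hr)
  have h2 : Tendsto (fun r => L * M * (r - s)) (𝓝[>] s) (𝓝 0) := by
    have : Continuous fun r => L * M * (r - s) := by fun_prop
    simpa using (this.tendsto s).mono_left nhdsWithin_le_nhds
  refine le_of_tendsto_of_tendsto
    (((continuous_infDist_pt (G (z s))).tendsto _).comp h1) h2 ?_
  filter_upwards [self_mem_nhdsWithin] with r hr
  simpa [slope] using hz.quot s r hr

theorem isTraj [FiniteDimensional ℝ E] (hG : LipMultimap G L M) (hz : QuotTraj G L M z)
    (a b : ℝ) : IsTraj G a b z (deriv z) := by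
  have hL := hz.lipschitzWith
  refine ⟨⟨intervalIntegrable_of_norm_le (aestronglyMeasurable_deriv z volume)
    (fun s => norm_deriv_le_of_lipschitz hL) a b, fun s _ => ?_, ?_⟩, ?_⟩
  · rw [integral_deriv_eq_sub_of_lipschitzWith hL]; abel
  · filter_upwards [hz.ae_deriv_mem hG] with s hs _ using hs.1
  · filter_upwards [hz.ae_deriv_mem hG] with s hs _ using hs.2

/-- Trajectories depend Lipschitz continuously on a prescribed value. -/
theorem exists_near [FiniteDimensional ℝ E] (hG : LipMultimap G L M) (hz : QuotTraj G L M z)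
    (a : ℝ) (w : E) : ∃ y, QuotTraj G L M y ∧ y a = w ∧
      ∀ s, ‖y s - z s‖ ≤ (1 + Real.exp (2 * L * |s - a|)) * ‖w - z a‖ := by
  have hL := hz.lipschitzWith
  set u₀ : ℝ → E := fun s => nearestPt (G (z s)) (deriv z s)
  have hmeas : AEStronglyMeasurable u₀ volume := hG.continuous_nearestPt.comp_aestronglyMeasurable
    (hL.continuous.aestronglyMeasurable.prodMk (aestronglyMeasurable_deriv z volume))
  have hmem : ∀ s, u₀ s ∈ G (z s) := fun s => hG.nearestPt_mem _ _
  have hint : ∀ s, ∫ q in a..s, u₀ q = z s - z a := fun s => by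
    rw [← integral_deriv_eq_sub_of_lipschitzWith hL]
    refine intervalIntegral.integral_congr_ae ?_
    filter_upwards [hz.ae_deriv_mem hG] with q hq _ using hG.nearestPt_eq hq.2
  obtain ⟨y, hy, hya, hys⟩ := hG.filippov a w hmeas fun s => hG.bound _ _ (hmem s)
  refine ⟨y, hy, hya, fun s => ?_⟩
  have h1 := hys s (L * ‖w - z a‖) (mul_nonneg hG.pos.le (norm_nonneg _)) fun r _ => by
    have h := hG.lip (z r) (w + ∫ q in a..r, u₀ q) (u₀ r) (hmem r)
    rw [hint] at h ⊢
    rwa [show z r - (w + (z r - z a)) = -(w - z a) by abel, norm_neg] at h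
  rw [hint, mul_div_cancel_left₀ _ hG.pos.ne'] at h1
  have h2 : y s - z s = (y s - (w + (z s - z a))) + (w - z a) := by abel
  rw [h2]
  refine (norm_add_le _ _).trans ?_
  linarith

theorem exists_ultrafilter_limit [FiniteDimensional ℝ E] (hG : LipMultimap G L M) {ι : Type*}
    (U : Ultrafilter ι) {y : ι → ℝ → E} (hy : ∀ i, QuotTraj G L M (y i)) {a R : ℝ}
    (hR : ∀ i, ‖y i a‖ ≤ R) :
    ∃ z, QuotTraj G L M z ∧ ∀ s, Tendsto (fun i => y i s) U (𝓝 (z s)) := by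
  have hlim : ∀ s, ∃ v, Tendsto (fun i => y i s) U (𝓝 v) := fun s => by
    have hK : IsCompact (closedBall (0 : E) (R + M * |s - a|)) := isCompact_closedBall _ _
    have hmem : ↑(U.map fun i => y i s) ≤ 𝓟 (closedBall (0 : E) (R + M * |s - a|)) := by
      rw [Ultrafilter.coe_map, le_principal_iff, mem_map]
      refine Eventually.of_forall fun i => ?_
      have h1 := (hy i).lip s a
      have h2 := norm_le_norm_add_norm_sub' (y i s) (y i a)
      have h3 := hR i
      simp only [mem_closedBall, dist_zero_right]
      linarith
    obtain ⟨v, -, hv⟩ := hK.ultrafilter_le_nhds _ hmem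
    exact ⟨v, hv⟩
  choose z hz using hlim
  refine ⟨z, ⟨fun s r => ?_, fun s r hsr => ?_⟩, hz⟩
  · exact le_of_tendsto ((hz s).sub (hz r)).norm (Eventually.of_forall fun i => (hy i).lip s r)
  · have h : Tendsto (fun i => (r - s)⁻¹ • (y i r - y i s)) U (𝓝 ((r - s)⁻¹ • (z r - z s))) :=
      ((hz r).sub (hz s)).const_smul _
    exact le_of_tendsto ((hG.continuous_infDist.tendsto (z s, _)).comp ((hz s).prodMk_nhds h))
      (Eventually.of_forall fun i => (hy i).quot s r hsr)

end QuotTraj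

theorem ACArc.continuousOn {x x' : ℝ → E} {a b : ℝ} (h : ACArc a b x x') (hab : a ≤ b) :
    ContinuousOn x (Icc a b) := by
  have h1 : ContinuousOn (fun s => x a + ∫ q in a..s, x' q) (Icc a b) :=
    continuousOn_const.add (intervalIntegral.continuousOn_primitive_interval' h.1 (by simp) |>.mono
      (by rw [uIcc_of_le hab]))
  exact h1.congr fun s hs => h.2.1 s hs

theorem IsTraj.exists_quotTraj [FiniteDimensional ℝ E] {G : E → Set E} {L M a b : ℝ}
    {y y' : ℝ → E} (hG : LipMultimap G L M) (hab : a ≤ b) (hy : IsTraj G a b y y') :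
    ∃ z, QuotTraj G L M z ∧ ∀ s ∈ Icc a b, z s = y s := by
  obtain ⟨hac, hmem⟩ := hy
  set u₀ : ℝ → E := (Icc a b).indicator fun s => nearestPt (G (y s)) (y' s) with hu₀
  have hmeas : AEStronglyMeasurable u₀ volume := by
    rw [hu₀, aestronglyMeasurable_indicator_iff measurableSet_Icc]
    refine hG.continuous_nearestPt.comp_aestronglyMeasurable (AEStronglyMeasurable.prodMk
      ((hac.continuousOn hab).aestronglyMeasurable measurableSet_Icc) ?_)
    rw [Measure.restrict_congr_set Ioc_ae_eq_Icc.symm]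
    exact ((intervalIntegrable_iff_integrableOn_Ioc_of_le hab).1 hac.1).aestronglyMeasurable
  have hM : ∀ s, ‖u₀ s‖ ≤ M := fun s => by
    refine (norm_indicator_le_norm_self _ _).trans ?_
    exact hG.bound _ _ (hG.nearestPt_mem _ _)
  have hint : ∀ s ∈ Icc a b, y a + ∫ q in a..s, u₀ q = y s := fun s hs => by
    rw [hac.2.1 s hs]
    congr 1
    refine intervalIntegral.integral_congr_ae ?_
    filter_upwards [hmem] with q hq hq'
    rw [uIoc_of_le hs.1] at hq'
    have hq'' : q ∈ Icc a b := ⟨hq'.1.le, hq'.2.trans hs.2⟩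
    rw [hu₀, indicator_of_mem hq'']
    exact hG.nearestPt_eq (hq hq'')
  obtain ⟨z, hz, hza, hzs⟩ := hG.filippov a (y a) hmeas hM
  refine ⟨z, hz, fun s hs => ?_⟩
  have h := hzs s 0 le_rfl fun r hr => by
    rw [uIcc_of_le hs.1] at hr
    have hr' : r ∈ Icc a b := ⟨hr.1, hr.2.trans hs.2⟩
    rw [hint r hr', hu₀, indicator_of_mem hr']
    exact (hG.mem_iff_infDist.1 (hG.nearestPt_mem _ _)).le
  rw [hint s hs, zero_div, zero_mul] at h
  exact sub_eq_zero.1 (norm_le_zero_iff.1 h)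

/-- The radial retraction of `E` onto the closed ball of radius `R`. -/
def radialRetraction (R : ℝ) (x : E) : E := (R / max R ‖x‖) • x

theorem radialRetraction_of_norm_le {R : ℝ} (hR : 0 < R) {x : E} (hx : ‖x‖ ≤ R) :
    radialRetraction R x = x := by
  rw [radialRetraction, max_eq_left hx, div_self hR.ne', one_smul]

theorem norm_radialRetraction {R : ℝ} (hR : 0 < R) (x : E) :
    ‖radialRetraction R x‖ = R / max R ‖x‖ * ‖x‖ := by
  rw [radialRetraction, norm_smul, Real.norm_of_nonneg (by positivity)]

theorem norm_radialRetraction_le {R : ℝ} (hR : 0 < R) (x : E) : ‖radialRetraction R x‖ ≤ R := by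
  have hm : 0 < max R ‖x‖ := lt_max_of_lt_left hR
  rw [norm_radialRetraction hR, div_mul_eq_mul_div, div_le_iff₀ hm]
  gcongr
  exact le_max_right _ _

theorem norm_radialRetraction_le_norm {R : ℝ} (hR : 0 < R) (x : E) :
    ‖radialRetraction R x‖ ≤ ‖x‖ := by
  have hm : 0 < max R ‖x‖ := lt_max_of_lt_left hR
  rw [norm_radialRetraction hR]
  exact mul_le_of_le_one_left (norm_nonneg x) ((div_le_one hm).2 (le_max_left _ _))

theorem norm_radialRetraction_sub_le {R : ℝ} (hR : 0 < R) (x y : E) :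
    ‖radialRetraction R x - radialRetraction R y‖ ≤ 2 * ‖x - y‖ := by
  have hx : 0 < max R ‖x‖ := lt_max_of_lt_left hR
  have hy : 0 < max R ‖y‖ := lt_max_of_lt_left hR
  have e : radialRetraction R x - radialRetraction R y =
      (R / max R ‖x‖) • (x - y) + (R / max R ‖x‖ - R / max R ‖y‖) • y := by
    simp only [radialRetraction]; module
  have h1 : ‖(R / max R ‖x‖) • (x - y)‖ ≤ ‖x - y‖ := by
    rw [norm_smul, Real.norm_of_nonneg (by positivity)]
    exact mul_le_of_le_one_left (norm_nonneg _) ((div_le_one hx).2 (le_max_left _ _))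
  have h2 : ‖(R / max R ‖x‖ - R / max R ‖y‖) • y‖ ≤ ‖x - y‖ := by
    have e2 : R / max R ‖x‖ - R / max R ‖y‖ =
        (max R ‖y‖ - max R ‖x‖) * (R / max R ‖x‖) / max R ‖y‖ := by field_simp
    have h3 : |max R ‖y‖ - max R ‖x‖| ≤ ‖x - y‖ := by
      rw [norm_sub_rev, max_comm R, max_comm R]
      exact (abs_max_sub_max_le_abs _ _ _).trans (abs_norm_sub_norm_le y x)
    rw [norm_smul, e2, norm_div, norm_mul, Real.norm_eq_abs, Real.norm_of_nonneg hy.le,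
      Real.norm_of_nonneg (by positivity : 0 ≤ R / max R ‖x‖), div_mul_eq_mul_div, div_le_iff₀ hy]
    have h4 : R / max R ‖x‖ ≤ 1 := (div_le_one hx).2 (le_max_left _ _)
    calc _ ≤ ‖x - y‖ * 1 * max R ‖y‖ := by
          gcongr
          exact le_max_right _ _
      _ = _ := by ring
  rw [e]
  exact (norm_add_le _ _).trans (by linarith)

theorem StandingHyp.exists_lipschitz [FiniteDimensional ℝ E] {F : E → Set E}
    (hF : StandingHyp F) (R : ℝ) :
    ∃ L > 0, ∀ x ∈ closedBall (0 : E) R, ∀ y ∈ closedBall (0 : E) R, ∀ v ∈ F x,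
      infDist v (F y) ≤ L * ‖x - y‖ := by
  let f : E → TopologicalSpace.NonemptyCompacts E := fun x => ⟨⟨F x, (hF.1 x).2.2⟩, (hF.1 x).1⟩
  have hloc : LocallyLipschitz f := fun x => by
    obtain ⟨ε, hε, c, hc, h⟩ := hF.2.1 x
    refine ⟨c.toNNReal, ball x ε, ball_mem_nhds x hε, fun y hy z hz => ?_⟩
    have := h y hy z hz
    rw [ENNReal.ofReal_mul hc, ← edist_dist] at this
    exact this
  obtain ⟨K, hK⟩ :=
    (hloc.locallyLipschitzOn (s := closedBall (0 : E) R)).exists_lipschitzOnWith_of_compact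
      (isCompact_closedBall 0 R)
  refine ⟨K + 1, by positivity, fun x hx y hy v hv => ?_⟩
  have h1 := hK.dist_le_mul x hx y hy
  have h2 : infDist v (F y) ≤ dist (f x) (f y) :=
    infDist_le_hausdorffDist_of_mem hv (hausdorffEDist_ne_top_of_nonempty_of_bounded (hF.1 x).1
      (hF.1 y).1 (hF.1 x).2.2.isBounded (hF.1 y).2.2.isBounded)
  rw [dist_eq_norm] at h1
  nlinarith [norm_nonneg (x - y)]

theorem StandingHyp.exists_lipMultimap [FiniteDimensional ℝ E] {F : E → Set E}
    (hF : StandingHyp F) {R : ℝ} (hR : 0 < R) :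
    ∃ L M, LipMultimap (fun x => F (radialRetraction R x)) L M := by
  obtain ⟨L, hL, h⟩ := hF.exists_lipschitz R
  obtain ⟨r, hr, hgrow⟩ := hF.2.2
  have hmem : ∀ x : E, radialRetraction R x ∈ closedBall (0 : E) R := fun x => by
    simpa using norm_radialRetraction_le hR x
  refine ⟨2 * L, r * (1 + R), fun x => (hF.1 _).1, fun x => (hF.1 _).2.1, fun x => (hF.1 _).2.2,
    fun x y v hv => ?_, fun x v hv => (hgrow _ v hv).trans ?_, by positivity⟩
  · have h1 := h _ (hmem x) _ (hmem y) v hv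
    have h2 := mul_le_mul_of_nonneg_left (norm_radialRetraction_sub_le hR x y) hL.le
    linarith
  · gcongr
    exact norm_radialRetraction_le hR x

theorem IsTraj.norm_le {F : E → Set E} {r a b : ℝ} {y y' : ℝ → E} (hr : 0 < r)
    (hF : ∀ x, ∀ v ∈ F x, ‖v‖ ≤ r * (1 + ‖x‖)) (hab : a ≤ b) (hy : IsTraj F a b y y')
    {s : ℝ} (hs : s ∈ Icc a b) : ‖y s‖ ≤ 2 * (1 + ‖y a‖) * Real.exp (2 * r * (b - a)) := by
  have h := add_norm_le_exp_of_primitive (a := a) (b := b) (z := y) (u := y') hr zero_le_one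
    (by rw [uIcc_of_le hab]; exact hy.1.continuousOn hab)
    (by rw [uIcc_of_le hab]; exact hy.1.2.1)
    (by
      rw [uIcc_of_le hab]
      filter_upwards [hy.2] with q hq hq' using hF _ _ (hq hq')) (s := s)
    (by rwa [uIcc_of_le hab])
  rw [abs_of_nonneg (sub_nonneg.2 hs.1)] at h
  have h2 : Real.exp (2 * r * (s - a)) ≤ Real.exp (2 * r * (b - a)) := by
    gcongr; exact hs.2
  have h3 := mul_le_mul_of_nonneg_left h2 (show 0 ≤ 2 * (1 + ‖y a‖) by positivity)
  linarith

theorem IsTraj.congr {F G : E → Set E} {a b : ℝ} {y y' : ℝ → E} (hy : IsTraj F a b y y')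
    (h : ∀ s ∈ Icc a b, F (y s) = G (y s)) : IsTraj G a b y y' := by
  refine ⟨hy.1, ?_⟩
  filter_upwards [hy.2] with s hs hs'
  rw [← h s hs']
  exact hs hs'

theorem norm_le_of_mem_FSub {f : E → ℝ} {x q : E} {K : ℝ} (hK : 0 ≤ K) (hq : q ∈ FSub f x)
    (hf : ∀ᶠ y in 𝓝 x, f y - f x ≤ K * ‖y - x‖) : ‖q‖ ≤ K := by
  refine le_of_forall_pos_le_add fun ε hε => ?_
  rcases eq_or_ne q 0 with rfl | hq0
  · simpa using add_nonneg hK hε.le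
  have hc : Tendsto (fun h : ℝ => x + h • q) (𝓝[>] 0) (𝓝 x) := by
    have : Continuous fun h : ℝ => x + h • q := by fun_prop
    simpa using (this.tendsto 0).mono_left nhdsWithin_le_nhds
  obtain ⟨h, ⟨h1, h2⟩, h3⟩ :=
    ((hc.eventually ((hq ε hε).and hf)).and self_mem_nhdsWithin).exists
  have h3 : 0 < h := h3
  rw [add_sub_cancel_left, inner_smul_right, real_inner_self_eq_norm_sq] at h1
  rw [add_sub_cancel_left] at h2
  rw [norm_smul, Real.norm_of_nonneg h3.le] at h1 h2
  have hq' : 0 < h * ‖q‖ := mul_pos h3 (norm_pos_iff.2 hq0)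
  have : h * ‖q‖ * ‖q‖ ≤ h * ‖q‖ * (K + ε) := by nlinarith
  exact le_of_mul_le_mul_left this hq'

theorem LipMultimap.Ham_sub_le {G : E → Set E} {L M : ℝ} (hG : LipMultimap G L M) (x y p : E) :
    Ham G x p - Ham G y p ≤ L * ‖p‖ * ‖x - y‖ := by
  rw [sub_le_iff_le_add]
  have hbdd : BddAbove ((fun v => ⟪v, p⟫) '' G y) := by
    refine ⟨M * ‖p‖, ?_⟩
    rintro _ ⟨v, hv, rfl⟩
    exact (real_inner_le_norm v p).trans (by gcongr; exact hG.bound _ _ hv)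
  refine csSup_le ((hG.nonempty x).image _) ?_
  rintro _ ⟨v, hv, rfl⟩
  obtain ⟨w, hw, h⟩ := (hG.compact y).exists_infDist_eq_dist (hG.nonempty y) v
  have h1 : ⟪w, p⟫ ≤ Ham G y p := le_csSup hbdd ⟨w, hw, rfl⟩
  have h2 := real_inner_le_norm (v - w) p
  have h3 := hG.lip x y v hv
  rw [h, dist_eq_norm] at h3
  have h4 := mul_le_mul_of_nonneg_right h3 (norm_nonneg p)
  rw [inner_sub_left] at h2
  change ⟪v, p⟫ ≤ _
  linarith

/-- Dual arcs along a bounded arc with vanishing terminal value vanish identically. -/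
theorem dualArc_eq_zero {F : E → Set E} {R L M a b : ℝ} (hR : 0 < R)
    (hG : LipMultimap (fun x => F (radialRetraction R x)) L M) (hab : a ≤ b) {y p p' : ℝ → E}
    (hy : ∀ s ∈ Icc a b, ‖y s‖ < R) (hp : ACArc a b p p')
    (hp' : ∀ᵐ s, s ∈ Icc a b → -p' s ∈ FSub (fun z => Ham F z (p s)) (y s)) (hpb : p b = 0) :
    ∀ s ∈ Icc a b, p s = 0 := by
  have hbound : ∀ᵐ q, q ∈ uIcc b a → ‖p' q‖ ≤ L * (0 + ‖p q‖) := by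
    rw [uIcc_of_ge hab]
    filter_upwards [hp'] with q hq hq'
    rw [zero_add, ← norm_neg]
    refine norm_le_of_mem_FSub (mul_nonneg hG.pos.le (norm_nonneg _)) (hq hq') ?_
    filter_upwards [(isOpen_lt continuous_norm continuous_const).mem_nhds (hy q hq')] with x hx
    have h := hG.Ham_sub_le x (y q) (p q)
    simp only [Ham] at h ⊢
    rwa [radialRetraction_of_norm_le hR (le_of_lt hx),
      radialRetraction_of_norm_le hR (hy q hq').le] at h
  intro s hs
  have h := add_norm_le_exp_of_primitive (a := b) (b := a) (z := p) (u := p') hG.pos le_rfl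
    (by rw [uIcc_of_ge hab]; exact hp.continuousOn hab) (fun s hs => by
      rw [uIcc_of_ge hab] at hs
      have hi : ∀ c ∈ Icc a b, IntervalIntegrable p' volume a c := fun c hc =>
        hp.1.mono_set (by rw [uIcc_of_le hc.1, uIcc_of_le hab]; exact Icc_subset_Icc_right hc.2)
      rw [hp.2.1 s hs, hp.2.1 b (right_mem_Icc.2 hab),
        ← intervalIntegral.integral_interval_sub_left (hi s hs) (hi b (right_mem_Icc.2 hab))]
      abel) hbound (s := s) (by rwa [uIcc_of_ge hab])
  simpa [hpb] using h

theorem norm_gradient_le_of_optimal [FiniteDimensional ℝ E] {G : E → Set E} {L M s T : ℝ}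
    (hG : LipMultimap G L M) {W : ℝ → E → ℝ} {φ : E → ℝ} {z : ℝ → E} {q : ℝ × E}
    (hz : QuotTraj G L M z) (hφ : DifferentiableAt ℝ φ (z T)) (hopt : φ (z T) = W s (z s))
    (hW : ∀ᶠ η in 𝓝 (z s), ∀ y, QuotTraj G L M y → y s = η → W s η ≤ φ (y T))
    (hq : HasGradPair W s (z s) q) :
    ‖gradient φ (z T)‖ ≤ (1 + Real.exp (2 * L * |s - T|)) * ‖q.2‖ := by
  set C := 1 + Real.exp (2 * L * |s - T|)
  set v := gradient φ (z T)
  have hC0 : 0 < C := by positivity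
  rcases eq_or_ne v 0 with hv0 | hv0
  · rw [hv0, norm_zero]; positivity
  refine le_of_forall_pos_le_add fun ε₀ hε₀ => ?_
  set ε := ε₀ / (C + 1) with hεdef
  have hε : 0 < ε := by positivity
  choose y hy hyT hys using fun h : ℝ => hz.exists_near hG T (z T - h • v)
  have hw : Tendsto (fun h : ℝ => z T - h • v) (𝓝[>] 0) (𝓝 (z T)) := by
    have : Continuous fun h : ℝ => z T - h • v := by fun_prop
    simpa using (this.tendsto 0).mono_left nhdsWithin_le_nhds
  have hdist : ∀ h : ℝ, 0 ≤ h → ‖y h s - z s‖ ≤ C * (h * ‖v‖) := fun h hh => by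
    have := hys h s
    rwa [sub_sub_cancel_left, norm_neg, norm_smul, Real.norm_of_nonneg hh] at this
  have hη : Tendsto (fun h => y h s) (𝓝[>] 0) (𝓝 (z s)) := by
    rw [tendsto_iff_norm_sub_tendsto_zero]
    have h1 : Tendsto (fun h : ℝ => C * (h * ‖v‖)) (𝓝[>] 0) (𝓝 0) := by
      have : Continuous fun h : ℝ => C * (h * ‖v‖) := by fun_prop
      simpa using (this.tendsto 0).mono_left nhdsWithin_le_nhds
    refine tendsto_of_tendsto_of_tendsto_of_le_of_le' tendsto_const_nhds h1
      (Eventually.of_forall fun _ => norm_nonneg _) ?_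
    filter_upwards [self_mem_nhdsWithin] with h hh using hdist h (le_of_lt hh)
  have hφ' := (hasFDerivAt_iff_isLittleO.1 hφ.hasGradientAt.hasFDerivAt).def hε
  have hW' := (hasFDerivAt_iff_isLittleO.1 hq).def hε
  have hpair : Tendsto (fun h => (s, y h s)) (𝓝[>] 0) (𝓝 (s, z s)) :=
    tendsto_const_nhds.prodMk_nhds hη
  obtain ⟨h, ⟨⟨h1, h2⟩, h3⟩, h4⟩ :=
    ((((hw.eventually hφ').and (hpair.eventually hW')).and (hη.eventually hW)).and
      self_mem_nhdsWithin).exists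
  have hh : 0 < h := h4
  have hle := h3 (y h) (hy h) rfl
  rw [hyT] at hle
  have h1' := (abs_le.1 h1).2
  have h2' := (abs_le.1 h2).1
  have e1 : (InnerProductSpace.toDual ℝ E) v (z T - h • v - z T) = -(h * ‖v‖ * ‖v‖) := by
    rw [sub_sub_cancel_left, map_neg, map_smul, InnerProductSpace.toDual_apply_apply,
      real_inner_self_eq_norm_sq, smul_eq_mul]
    ring
  have e2 : ‖((s, y h s) : ℝ × E) - (s, z s)‖ = ‖y h s - z s‖ := by
    simp [Prod.norm_def]
  have e3 : (q.1 • ContinuousLinearMap.fst ℝ ℝ E +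
      (innerSL ℝ q.2).comp (ContinuousLinearMap.snd ℝ ℝ E)) ((s, y h s) - (s, z s)) =
      ⟪q.2, y h s - z s⟫ := by simp
  rw [e1, sub_sub_cancel_left, norm_neg, norm_smul, Real.norm_of_nonneg hh.le] at h1'
  rw [e2, e3] at h2'
  have h5 : -(‖q.2‖ * ‖y h s - z s‖) ≤ ⟪q.2, y h s - z s⟫ :=
    (abs_le.1 (abs_real_inner_le_norm _ _)).1
  have h6 := hdist h hh.le
  have h7 : (‖q.2‖ + ε) * ‖y h s - z s‖ ≤ (‖q.2‖ + ε) * (C * (h * ‖v‖)) := by gcongr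
  have hpos : 0 < h * ‖v‖ := mul_pos hh (norm_pos_iff.2 hv0)
  have h8 : h * ‖v‖ * ‖v‖ ≤ h * ‖v‖ * (C * ‖q.2‖ + (C + 1) * ε) := by
    simp only at h2'
    nlinarith
  have h9 := le_of_mul_le_mul_left h8 hpos
  rwa [hεdef, mul_div_cancel₀ _ (by positivity)] at h9

theorem isTraj_radialRetraction_iff {F : E → Set E} {r R a b : ℝ} (hr : 0 < r)
    (hF : ∀ x, ∀ v ∈ F x, ‖v‖ ≤ r * (1 + ‖x‖)) (hR : 0 < R) (hab : a ≤ b) {y y' : ℝ → E}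
    (hya : 2 * (1 + ‖y a‖) * Real.exp (2 * r * (b - a)) ≤ R) :
    IsTraj (fun x => F (radialRetraction R x)) a b y y' ↔ IsTraj F a b y y' := by
  have hG : ∀ x, ∀ v ∈ F (radialRetraction R x), ‖v‖ ≤ r * (1 + ‖x‖) := fun x v hv =>
    (hF _ v hv).trans (by gcongr; exact norm_radialRetraction_le_norm hR x)
  refine ⟨fun h => h.congr fun s hs => ?_, fun h => h.congr fun s hs => ?_⟩
  · rw [radialRetraction_of_norm_le hR ((h.norm_le hr hG hab hs).trans hya)]
  · rw [radialRetraction_of_norm_le hR ((h.norm_le hr hF hab hs).trans hya)]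

/-- The value function is attained by an arc of the truncated inclusion, as soon as both
inclusions have the same trajectories from the given initial point. -/
theorem isLeast_valueFn [FiniteDimensional ℝ E] {F G : E → Set E} {L M s T : ℝ} {φ : E → ℝ}
    {ξ : E} (hG : LipMultimap G L M) (hφ : Continuous φ) (hsT : s ≤ T)
    (hFG : ∀ y y' : ℝ → E, y s = ξ → (IsTraj G s T y y' ↔ IsTraj F s T y y')) :
    IsLeast {c | ∃ z, QuotTraj G L M z ∧ z s = ξ ∧ c = φ (z T)} (valueFn F φ T s ξ) := by
  set S := {c | ∃ z, QuotTraj G L M z ∧ z s = ξ ∧ c = φ (z T)}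
  have hval : valueFn F φ T s ξ = sInf S := by
    rw [valueFn]
    congr 1
    ext c
    constructor
    · rintro ⟨y, y', hy, hys, rfl⟩
      obtain ⟨z, hz, hzy⟩ := ((hFG y y' hys).2 hy).exists_quotTraj hG hsT
      exact ⟨z, hz, by rw [hzy s (left_mem_Icc.2 hsT), hys], by rw [hzy T (right_mem_Icc.2 hsT)]⟩
    · rintro ⟨z, hz, hzs, rfl⟩
      exact ⟨z, deriv z, (hFG _ _ hzs).1 (hz.isTraj hG s T), hzs, rfl⟩
  have hne : S.Nonempty := by
    obtain ⟨v, hv⟩ := hG.nonempty 0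
    obtain ⟨z, hz, hzs, -⟩ := hG.filippov (u₀ := fun _ => 0) s ξ aestronglyMeasurable_const
      fun _ => by simpa using (norm_nonneg v).trans (hG.bound 0 v hv)
    exact ⟨_, z, hz, hzs, rfl⟩
  have hbdd : BddBelow S := by
    obtain ⟨m, hm⟩ := ((isCompact_closedBall ξ (M * |T - s|)).image hφ).bddBelow
    refine ⟨m, ?_⟩
    rintro _ ⟨z, hz, hzs, rfl⟩
    refine hm ⟨z T, ?_, rfl⟩
    rw [mem_closedBall, dist_eq_norm, ← hzs]
    exact hz.lip T s
  rw [hval]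
  refine ⟨?_, fun c hc => csInf_le hbdd hc⟩
  obtain ⟨c, -, hc, hcS⟩ := exists_seq_tendsto_sInf hne hbdd
  choose z hz hzs hzT using hcS
  obtain ⟨w, hw, hlim⟩ := QuotTraj.exists_ultrafilter_limit hG (hyperfilter ℕ) hz (a := s)
    (R := ‖ξ‖) fun i => (congrArg norm (hzs i)).le
  have hle : (hyperfilter ℕ : Filter ℕ) ≤ atTop := Nat.hyperfilter_le_atTop
  refine ⟨w, hw, ?_, ?_⟩
  · have h1 := hlim s
    simp only [hzs] at h1
    exact tendsto_nhds_unique h1 tendsto_const_nhds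
  · refine tendsto_nhds_unique (hc.mono_left hle) ?_
    exact ((hφ.tendsto _).comp (hlim T)).congr fun i => (hzT i).symm

/-- Limits of optimal arcs issuing from converging initial points are optimal. -/
theorem QuotTraj.optimal_of_tendsto [FiniteDimensional ℝ E] {G : E → Set E} {L M t T : ℝ}
    {φ : E → ℝ} {x : E} (hG : LipMultimap G L M) (hφ : Continuous φ) {ι : Type*} {l : Filter ι}
    [l.NeBot] {s : ι → ℝ} {zs : ι → ℝ → E} {z y : ℝ → E} (hs : Tendsto s l (𝓝 t))
    (hx : Tendsto (fun i => zs i (s i)) l (𝓝 x)) (hzT : Tendsto (fun i => zs i T) l (𝓝 (z T)))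
    (hopt : ∀ i w, QuotTraj G L M w → w (s i) = zs i (s i) → φ (zs i T) ≤ φ (w T))
    (hy : QuotTraj G L M y) (hyt : y t = x) : φ (z T) ≤ φ (y T) := by
  choose w hw hws hwy using fun i => hy.exists_near hG (s i) (zs i (s i))
  have hys : Tendsto (fun i => zs i (s i) - y (s i)) l (𝓝 0) := by
    have := (hy.lipschitzWith.continuous.tendsto t).comp hs
    rw [hyt] at this
    simpa using hx.sub this
  have hwT : Tendsto (fun i => w i T) l (𝓝 (y T)) := by
    rw [tendsto_iff_norm_sub_tendsto_zero]
    refine squeeze_zero (fun _ => norm_nonneg _) (fun i => hwy i T) ?_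
    have hexp : Tendsto (fun i => 1 + Real.exp (2 * L * |T - s i|)) l
        (𝓝 (1 + Real.exp (2 * L * |T - t|))) := by
      have : Continuous fun s : ℝ => 1 + Real.exp (2 * L * |T - s|) := by fun_prop
      exact (this.tendsto t).comp hs
    simpa using hexp.mul hys.norm
  exact le_of_tendsto_of_tendsto' ((hφ.tendsto _).comp hzT) ((hφ.tendsto _).comp hwT)
    fun i => hopt i (w i) (hw i) (hws i)

theorem continuous_gradient [FiniteDimensional ℝ E] {φ : E → ℝ} (hφ : ContDiff ℝ 1 φ) :
    Continuous (gradient φ) :=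
  (InnerProductSpace.toDual ℝ E).symm.continuous.comp (hφ.continuous_fderiv one_ne_zero)

theorem exists_optimal_gradient_eq_zero [FiniteDimensional ℝ E] {F : E → Set E} {φ : E → ℝ}
    {t T : ℝ} {x : E} (hF : StandingHyp F) (hφ : ContDiff ℝ 1 φ) (htT : t < T)
    (h0 : (0 : ℝ × E) ∈ ReachGradPair (valueFn F φ T) t x) :
    ∃ y y' : ℝ → E, IsOptimal F φ t T x y y' ∧ gradient φ (y T) = 0 := by
  obtain ⟨r, hr, hgrow⟩ := hF.2.2
  set R : ℝ := 2 * (1 + (‖x‖ + 1)) * Real.exp (2 * r * (T - t + 1)) with hRdef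
  have hR : 0 < R := by positivity
  obtain ⟨L, M, hG⟩ := hF.exists_lipMultimap hR
  set G : E → Set E := fun x => F (radialRetraction R x)
  set U : Set (ℝ × E) := {p | p.1 < T ∧ T - p.1 < T - t + 1 ∧ ‖p.2‖ < ‖x‖ + 1}
  have hUopen : IsOpen U :=
    (isOpen_lt continuous_fst continuous_const).inter
      ((isOpen_lt (continuous_const.sub continuous_fst) continuous_const).inter
        (isOpen_lt continuous_snd.norm continuous_const))
  have hxU : (t, x) ∈ U := ⟨htT, by simp, by simp⟩
  have hFG : ∀ p ∈ U, ∀ y y' : ℝ → E, y p.1 = p.2 →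
      (IsTraj G p.1 T y y' ↔ IsTraj F p.1 T y y') := fun p hp y y' hy =>
    isTraj_radialRetraction_iff hr hgrow hR hp.1.le (by
      rw [hy, hRdef]
      gcongr
      exacts [hp.2.2.le, hp.2.1.le])
  have hleast := fun p (hp : p ∈ U) => isLeast_valueFn hG hφ.continuous hp.1.le (hFG p hp)
  obtain ⟨u, g, hug, hu, hg⟩ := h0
  obtain ⟨N, hN⟩ := eventually_atTop.1 (hu.eventually (hUopen.mem_nhds hxU))
  replace hN : ∀ i, u (i + N) ∈ U := fun i => hN _ (Nat.le_add_left _ _)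
  replace hu := hu.comp (tendsto_add_atTop_nat N)
  replace hg := hg.comp (tendsto_add_atTop_nat N)
  replace hug := fun i => hug (i + N)
  choose z hz hzu hzT using fun i => (hleast _ (hN i)).1
  have hu1 : Tendsto (fun i => (u (i + N)).1) atTop (𝓝 t) := (continuous_fst.tendsto _).comp hu
  have hu2 : Tendsto (fun i => (u (i + N)).2) atTop (𝓝 x) := (continuous_snd.tendsto _).comp hu
  have hgrad : Tendsto (fun i => gradient φ (z i T)) atTop (𝓝 0) := by
    have hbound : ∀ i, ‖gradient φ (z i T)‖ ≤
        (1 + Real.exp (2 * L * |(u (i + N)).1 - T|)) * ‖(g (i + N)).2‖ := fun i =>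
      norm_gradient_le_of_optimal hG (hz i) (hφ.differentiable one_ne_zero _)
        (W := valueFn F φ T) (by rw [hzu]; exact (hzT i).symm)
        (by
          have hc : Tendsto (fun η => ((u (i + N)).1, η)) (𝓝 (u (i + N)).2) (𝓝 (u (i + N))) :=
            (Continuous.prodMk_right _).tendsto _
          rw [hzu]
          filter_upwards [hc.eventually (hUopen.mem_nhds (hN i))] with η hη y hy hys
          exact (hleast ((u (i + N)).1, η) hη).2 ⟨y, hy, hys, rfl⟩)
        (by rw [hzu]; exact hug i)
    refine squeeze_zero_norm hbound ?_
    have hexp : Continuous fun s : ℝ => 1 + Real.exp (2 * L * |s - T|) := by fun_prop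
    have hg2 : Tendsto (fun i => (g (i + N)).2) atTop (𝓝 0) := (continuous_snd.tendsto _).comp hg
    simpa using ((hexp.tendsto t).comp hu1).mul hg2.norm
  obtain ⟨C, hC⟩ := (((hu1.sub_const t).norm.const_mul M).add hu2.norm).bddAbove_range
  obtain ⟨y, hy, hlim⟩ := QuotTraj.exists_ultrafilter_limit hG (hyperfilter ℕ) hz (a := t)
    (R := C) fun i => by
      have h1 := (hz i).lip t (u (i + N)).1
      have h2 := hC (mem_range_self i)
      rw [hzu, abs_sub_comm] at h1
      have h3 := norm_le_norm_add_norm_sub' (z i t) (u (i + N)).2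
      rw [Real.norm_eq_abs] at h2
      linarith
  have hle : (hyperfilter ℕ : Filter ℕ) ≤ atTop := Nat.hyperfilter_le_atTop
  have hyt : y t = x := by
    have h1 : Tendsto (fun i => z i t - (u (i + N)).2) atTop (𝓝 0) := by
      refine squeeze_zero_norm (a := fun i => M * |t - (u (i + N)).1|) (fun i => ?_) ?_
      · rw [← hzu]
        exact (hz i).lip _ _
      · simpa using ((tendsto_const_nhds (x := t)).sub hu1).abs.const_mul M
    have h2 := h1.add hu2
    simp only [sub_add_cancel, zero_add] at h2
    exact tendsto_nhds_unique (hlim t) (h2.mono_left hle)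
  refine ⟨y, deriv y, ⟨(hFG _ hxU _ _ hyt).1 (hy.isTraj hG t T), hyt, fun w w' hw hwt => ?_⟩, ?_⟩
  · obtain ⟨v, hv, hvw⟩ := ((hFG _ hxU w w' hwt).2 hw).exists_quotTraj hG htT.le
    rw [← hvw T (right_mem_Icc.2 htT.le)]
    refine QuotTraj.optimal_of_tendsto hG hφ.continuous (hu1.mono_left hle) (zs := z)
      (by simpa only [hzu] using hu2.mono_left hle) (hlim T) (fun i w hw hws => ?_) hv
      ((hvw t (left_mem_Icc.2 htT.le)).trans hwt)
    rw [← hzT]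
    exact (hleast _ (hN i)).2 ⟨w, hw, hws.trans (hzu i), rfl⟩
  · exact tendsto_nhds_unique (((continuous_gradient hφ).tendsto _).comp (hlim T))
      (hgrad.mono_left hle)

/-- Theorem 5.4.
Under (SH), (H1), `φ ∈ C¹`, if `0 ∈ ∂*V(t,x)` for some `(t,x) ∈ [t₀,T)×ℝⁿ`, then there
is an optimal trajectory `y` for `P(t,x)` with `∇φ(y(T)) = 0`; consequently the unique
dual arc associated with `y` (solving `−p' ∈ ∂ₓ⁻H(y,p)` a.e. with `p(T) = −∇φ(y(T)) = 0`)
vanishes identically. -/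
theorem stmt6 {n : ℕ} (F : Euc n → Set (Euc n)) (φ : Euc n → ℝ) (t0 T : ℝ)
    (hSH : StandingHyp F) (hH1 : HypH1 F) (hφ : ContDiff ℝ 1 φ)
    (t : ℝ) (x : Euc n) (ht : t ∈ Ico t0 T)
    (h0 : (0 : ℝ × Euc n) ∈ ReachGradPair (valueFn F φ T) t x) :
    ∃ y y' : ℝ → Euc n, IsOptimal F φ t T x y y' ∧ gradient φ (y T) = 0 ∧
      ∀ p p' : ℝ → Euc n, ACArc t T p p' →
        (∀ᵐ s ∂volume, s ∈ Icc t T → -p' s ∈ FSub (fun z => Ham F z (p s)) (y s)) →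
        p T = 0 → ∀ s ∈ Icc t T, p s = 0 := by
  obtain ⟨y, y', hy, hgrad⟩ := exists_optimal_gradient_eq_zero hSH hφ ht.2 h0
  refine ⟨y, y', hy, hgrad, fun p p' hp hp' hpT => ?_⟩
  obtain ⟨r, hr, hgrow⟩ := hSH.2.2
  have hR : 0 < 2 * (1 + ‖y t‖) * Real.exp (2 * r * (T - t)) + 1 := by positivity
  obtain ⟨L, M, hG⟩ := hSH.exists_lipMultimap hR
  exact dualArc_eq_zero hR hG ht.2.le
    (fun s hs => (hy.1.norm_le hr hgrow ht.2.le hs).trans_lt (lt_add_one _)) hp hp' hpT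

end
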